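/- Two Legendrian immersed loops γ̄₀, γ̄₁ : ℝ → ℝ³ in (ℝ³, ξ) are Legendrian regularly homotopic if and only if rot(γ̄₀) = rot(γ̄₁); that is, there exists a smooth map H : [0,1] × ℝ → ℝ³ with each H_t a Legendrian immersed loop, H_0 = γ̄₀ and H_1 = γ̄₁, if and only if their rotation numbers agree. -/

import Mathlib

/-- A Legendrian immersed loop in `(ℝ³, ξ)`, `ξ = ker(dz - y dx)`: a smooth
1-periodic curve `γ̄ = (x,y,z)` with nowhere-vanishing derivative satisfying
`z' = y·x'`. -/
structure IsLegendrianLoop (γ : ℝ → ℝ × ℝ × ℝ) : Prop where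
  smooth : ContDiff ℝ (⊤ : ℕ∞) γ
  periodic : Function.Periodic γ 1
  immersed : ∀ s : ℝ, deriv γ s ≠ 0
  tangent : ∀ s : ℝ, deriv (fun t => (γ t).2.2) s
      = (γ s).2.1 * deriv (fun t => (γ t).1) s

/-- `rot(γ̄) = n`: the winding number of `s ↦ (x'(s), y'(s))` around the origin
over one period equals `n`, expressed via a continuous angle function `θ`. -/
def HasLegRotationNumber (γ : ℝ → ℝ × ℝ × ℝ) (n : ℤ) : Prop :=
  ∃ θ : ℝ → ℝ, Continuous θ ∧
    (∀ s : ℝ,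
      deriv (fun t => (γ t).1) s
        = Real.sqrt ((deriv (fun t => (γ t).1) s) ^ 2
            + (deriv (fun t => (γ t).2.1) s) ^ 2) * Real.cos (θ s) ∧
      deriv (fun t => (γ t).2.1) s
        = Real.sqrt ((deriv (fun t => (γ t).1) s) ^ 2
            + (deriv (fun t => (γ t).2.1) s) ^ 2) * Real.sin (θ s)) ∧
    θ 1 - θ 0 = 2 * Real.pi * (n : ℝ)

/-- A Legendrian regular homotopy: a smooth map `H : [0,1] × ℝ → ℝ³` such that
each `H t` (for `t ∈ [0,1]`) is a Legendrian immersed loop. -/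
def IsLegendrianRegularHomotopy (H : ℝ → ℝ → ℝ × ℝ × ℝ) : Prop :=
  ContDiffOn ℝ (⊤ : ℕ∞) (Function.uncurry H) (Set.Icc (0:ℝ) 1 ×ˢ (Set.univ : Set ℝ)) ∧
  ∀ t ∈ Set.Icc (0:ℝ) 1, IsLegendrianLoop (H t)

open Set Filter Topology MeasureTheory
open scoped ContDiff

/-! ### Smooth dependence on parameters -/

/-- Differentiation under the integral sign for `C¹` integrands. -/
theorem hasFDerivAt_intervalIntegral_of_contDiff {E F : Type}
    [NormedAddCommGroup E] [NormedSpace ℝ E] [FiniteDimensional ℝ E]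
    [NormedAddCommGroup F] [NormedSpace ℝ F]
    {g : E × ℝ → F} (hg : ContDiff ℝ 1 g) (e : E) :
    HasFDerivAt (fun e => ∫ τ in (0:ℝ)..1, g (e, τ))
      (∫ τ in (0:ℝ)..1, (fderiv ℝ g (e, τ)).comp (ContinuousLinearMap.inl ℝ E ℝ)) e := by
  have hcont : Continuous fun p : E × ℝ =>
      (fderiv ℝ g p).comp (ContinuousLinearMap.inl ℝ E ℝ) :=
    (hg.continuous_fderiv one_ne_zero).clm_comp continuous_const
  obtain ⟨C, hC⟩ := ((isCompact_closedBall e 1).prod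
    (isCompact_Icc (a := (0:ℝ)) (b := 1))).exists_bound_of_continuousOn hcont.continuousOn
  refine intervalIntegral.hasFDerivAt_integral_of_dominated_of_fderiv_le
    (F := fun e τ => g (e, τ))
    (F' := fun e τ => (fderiv ℝ g (e, τ)).comp (ContinuousLinearMap.inl ℝ E ℝ))
    (bound := fun _ => C) (Metric.closedBall_mem_nhds e one_pos) ?_ ?_ ?_ ?_ ?_ ?_
  · exact Eventually.of_forall fun x =>
      (hg.continuous.comp (by fun_prop : Continuous fun τ : ℝ => (x, τ))).aestronglyMeasurable
  · exact (hg.continuous.comp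
      (by fun_prop : Continuous fun τ : ℝ => (e, τ))).intervalIntegrable _ _
  · exact (hcont.comp (by fun_prop : Continuous fun τ : ℝ => (e, τ))).aestronglyMeasurable
  · refine Eventually.of_forall fun τ hτ x hx => hC (x, τ) ⟨hx, ?_⟩
    rw [uIoc_of_le zero_le_one] at hτ
    exact ⟨hτ.1.le, hτ.2⟩
  · exact intervalIntegrable_const
  · refine Eventually.of_forall fun τ _ x _ => ?_
    exact ((hg.differentiable one_ne_zero (x, τ)).hasFDerivAt).comp x (hasFDerivAt_prodMk_left x τ)

theorem contDiff_nat_intervalIntegral {E : Type}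
    [NormedAddCommGroup E] [NormedSpace ℝ E] [FiniteDimensional ℝ E] (n : ℕ) :
    ∀ {F : Type} [NormedAddCommGroup F] [NormedSpace ℝ F] {g : E × ℝ → F},
      ContDiff ℝ ∞ g → ContDiff ℝ n (fun e => ∫ τ in (0:ℝ)..1, g (e, τ)) := by
  induction n with
  | zero =>
    intro F _ _ g hg
    exact contDiff_zero.2
      (intervalIntegral.continuous_parametric_intervalIntegral_of_continuous'
        (f := fun e τ => g (e, τ)) hg.continuous 0 1)
  | succ n ih =>
    intro F _ _ g hg
    have hd := hasFDerivAt_intervalIntegral_of_contDiff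
      (hg.of_le (by exact_mod_cast le_top))
    rw [Nat.cast_succ, contDiff_succ_iff_fderiv]
    refine ⟨fun e => (hd e).differentiableAt, by simp, ?_⟩
    rw [funext fun e => (hd e).fderiv]
    exact ih (g := fun p => (fderiv ℝ g p).comp (ContinuousLinearMap.inl ℝ E ℝ))
      ((hg.fderiv_right (by simp)).clm_comp contDiff_const)

/-- The integral over `[0, 1]` of a smooth family of functions is smooth in the parameter. -/
theorem contDiff_intervalIntegral {E F : Type}
    [NormedAddCommGroup E] [NormedSpace ℝ E] [FiniteDimensional ℝ E]
    [NormedAddCommGroup F] [NormedSpace ℝ F]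
    {g : E × ℝ → F} (hg : ContDiff ℝ ∞ g) :
    ContDiff ℝ ∞ (fun e => ∫ τ in (0:ℝ)..1, g (e, τ)) :=
  contDiff_infty.2 fun n => contDiff_nat_intervalIntegral n hg

/-- Primitives of a smooth family of functions form a smooth family. -/
theorem contDiff_primitive {g : ℝ × ℝ → ℝ} (hg : ContDiff ℝ ∞ g) :
    ContDiff ℝ ∞ (fun p : ℝ × ℝ => ∫ σ in (0:ℝ)..p.2, g (p.1, σ)) := by
  have h : (fun p : ℝ × ℝ => ∫ σ in (0:ℝ)..p.2, g (p.1, σ)) =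
      fun p : ℝ × ℝ => p.2 * ∫ τ in (0:ℝ)..1, g (p.1, p.2 * τ) := by
    funext p
    have := intervalIntegral.smul_integral_comp_mul_left
      (a := 0) (b := 1) (fun σ => g (p.1, σ)) p.2
    simpa using this.symm
  rw [h]
  refine contDiff_snd.mul
    (contDiff_intervalIntegral (g := fun q : (ℝ × ℝ) × ℝ => g (q.1.1, q.1.2 * q.2)) ?_)
  exact hg.comp (by fun_prop)

/-- The partial derivative in the second variable of a family that is smooth on `T × ℝ`. -/
theorem ContDiffOn.deriv_snd {F : Type*} [NormedAddCommGroup F] [NormedSpace ℝ F]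
    {T : Set ℝ} (hT : UniqueDiffOn ℝ T) {g : ℝ → ℝ → F}
    (hg : ContDiffOn ℝ ∞ (Function.uncurry g) (T ×ˢ univ)) :
    ContDiffOn ℝ ∞ (Function.uncurry fun t s => deriv (g t) s) (T ×ˢ univ) := by
  have hU : UniqueDiffOn ℝ (T ×ˢ (univ : Set ℝ)) := hT.prod uniqueDiffOn_univ
  have h1 : ContDiffOn ℝ ∞
      (fun p => fderivWithin ℝ (Function.uncurry g) (T ×ˢ univ) p ((0:ℝ), (1:ℝ)))
      (T ×ˢ univ) :=
    (hg.fderivWithin hU (by simp)).clm_apply contDiffOn_const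
  refine h1.congr ?_
  rintro ⟨t, s⟩ hp
  have h2 := (hg.differentiableOn (by simp) (t, s) hp).hasFDerivWithinAt
  have h3 : HasDerivWithinAt (fun s : ℝ => (t, s)) ((0:ℝ), (1:ℝ)) univ s :=
    ((hasDerivAt_const s t).prodMk (hasDerivAt_id s)).hasDerivWithinAt
  have h4 := h2.comp_hasDerivWithinAt s h3 (fun x _ => ⟨hp.1, mem_univ _⟩)
  exact (h4.hasDerivAt univ_mem).deriv

theorem ContDiff.deriv_snd {F : Type*} [NormedAddCommGroup F] [NormedSpace ℝ F]
    {g : ℝ → ℝ → F} (hg : ContDiff ℝ ∞ (Function.uncurry g)) :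
    ContDiff ℝ ∞ (Function.uncurry fun t s => deriv (g t) s) := by
  rw [← contDiffOn_univ, ← univ_prod_univ] at hg ⊢
  exact hg.deriv_snd uniqueDiffOn_univ

/-! ### Angle functions -/

/-- A continuous function on `ℝ` with integer values is constant. -/
theorem eq_of_continuous_of_int_valued {f : ℝ → ℝ} (hf : Continuous f)
    (hinteger : ∀ s, ∃ k : ℤ, f s = k) (a b : ℝ) : f a = f b := by
  choose k hk using hinteger
  have hkc : Continuous k := by
    rw [Int.isClosedEmbedding_coe_real.isInducing.continuous_iff]
    exact hf.congr hk
  rw [hk, hk, PreconnectedSpace.constant inferInstance hkc (x := a) (y := b)]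

theorem exp_integral_logDeriv {u : ℝ → ℂ} (hu : ContDiff ℝ 1 u) (h0 : ∀ s, u s ≠ 0) (s : ℝ) :
    Complex.exp (∫ σ in (0:ℝ)..s, deriv u σ / u σ) = u s / u 0 := by
  have hc : Continuous fun σ => deriv u σ / u σ :=
    (hu.continuous_deriv le_rfl).div hu.continuous h0
  have hL : ∀ s, HasDerivAt (fun s => ∫ σ in (0:ℝ)..s, deriv u σ / u σ)
      (deriv u s / u s) s := fun s => hc.integral_hasStrictDerivAt 0 s |>.hasDerivAt
  have hE : ∀ s, HasDerivAt
      (fun s => u s * Complex.exp (-∫ σ in (0:ℝ)..s, deriv u σ / u σ)) 0 s := by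
    intro s
    have h1 := ((hu.differentiable one_ne_zero s).hasDerivAt).mul (hL s).neg.cexp
    refine h1.congr_deriv ?_
    have := h0 s
    field_simp
    ring
  have hconst := is_const_of_deriv_eq_zero (fun s => (hE s).differentiableAt)
    (fun s => (hE s).deriv) s 0
  simp only [intervalIntegral.integral_same, neg_zero, Complex.exp_zero, mul_one] at hconst
  rw [eq_div_iff (h0 0), ← hconst, Complex.exp_neg]
  field_simp [Complex.exp_ne_zero]

/-- A continuous angle function is recovered by integrating the logarithmic derivative. -/
theorem angle_sub_eq_integral {u : ℝ → ℂ} (hu : ContDiff ℝ 1 u) (h0 : ∀ s, u s ≠ 0)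
    {θ : ℝ → ℝ} (hθ : Continuous θ) (hang : ∀ s, u s = ‖u s‖ * Complex.exp (θ s * Complex.I))
    (s : ℝ) :
    θ s - θ 0 = (∫ σ in (0:ℝ)..s, deriv u σ / u σ).im := by
  have hc : Continuous fun σ => deriv u σ / u σ :=
    (hu.continuous_deriv le_rfl).div hu.continuous h0
  set L : ℝ → ℂ := fun s => ∫ σ in (0:ℝ)..s, deriv u σ / u σ with hLdef
  have hLc : Continuous L := intervalIntegral.continuous_primitive
    (fun a b => hc.intervalIntegrable a b) 0
  have hinteger : ∀ s, ∃ k : ℤ, (θ s - θ 0 - (L s).im) / (2 * Real.pi) = k := by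
    intro s
    have h1 : Complex.exp (L s) = u s / u 0 := exp_integral_logDeriv hu h0 s
    have h2 : ‖Complex.exp (L s)‖ = ‖u s‖ / ‖u 0‖ := by rw [h1, norm_div]
    have h3 : Complex.exp (L s) = ‖Complex.exp (L s)‖ * Complex.exp ((L s).im * Complex.I) := by
      rw [Complex.norm_exp, Complex.ofReal_exp, ← Complex.exp_add, Complex.re_add_im]
    have hs : (‖u s‖ : ℂ) ≠ 0 := by exact_mod_cast norm_ne_zero_iff.2 (h0 s)
    have hz : (‖u 0‖ : ℂ) ≠ 0 := by exact_mod_cast norm_ne_zero_iff.2 (h0 0)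
    have h4 : Complex.exp ((θ s - θ 0 - (L s).im : ℝ) * Complex.I) = 1 := by
      rw [h2] at h3
      have h5 : u s / u 0 = ((‖u s‖ / ‖u 0‖ : ℝ) : ℂ) *
          (Complex.exp (θ s * Complex.I) / Complex.exp (θ 0 * Complex.I)) := by
        conv_lhs => rw [hang s, hang 0]
        push_cast
        rw [mul_div_mul_comm]
      rw [h1, h5] at h3
      have h6 := mul_left_cancel₀ (by push_cast; exact div_ne_zero hs hz) h3
      push_cast
      rw [sub_mul, sub_mul, Complex.exp_sub, Complex.exp_sub, h6,
        div_self (Complex.exp_ne_zero _)]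
    obtain ⟨k, hk⟩ := Complex.exp_eq_one_iff.1 h4
    refine ⟨k, ?_⟩
    have h7 : ((θ s - θ 0 - (L s).im : ℝ) : ℂ) = ((k * (2 * Real.pi) : ℝ) : ℂ) := by
      apply mul_right_cancel₀ Complex.I_ne_zero
      rw [hk]
      push_cast
      ring
    rw [Complex.ofReal_inj.1 h7]
    field_simp
  have hcon := eq_of_continuous_of_int_valued
    (f := fun s => (θ s - θ 0 - (L s).im) / (2 * Real.pi)) (by fun_prop) hinteger s 0
  have hL0 : L 0 = 0 := intervalIntegral.integral_same
  have hpi := Real.pi_pos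
  simp only [sub_self, hL0, Complex.zero_im, zero_div] at hcon
  rcases div_eq_zero_iff.1 hcon with h | h
  · change θ s - θ 0 = (L s).im
    linarith
  · exact absurd h (by positivity)

/-- The integral of the logarithmic derivative over a period lies in `2πiℤ`. -/
theorem exists_int_integral_logDeriv {u : ℝ → ℂ} (hu : ContDiff ℝ 1 u) (h0 : ∀ s, u s ≠ 0)
    (hp : u 1 = u 0) :
    ∃ k : ℤ, (∫ σ in (0:ℝ)..1, deriv u σ / u σ).im / (2 * Real.pi) = k := by
  have h := exp_integral_logDeriv hu h0 1
  rw [hp, div_self (h0 0)] at h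
  obtain ⟨k, hk⟩ := Complex.exp_eq_one_iff.1 h
  refine ⟨k, ?_⟩
  rw [hk]
  have : ((k : ℂ) * (2 * Real.pi * Complex.I)).im = k * (2 * Real.pi) := by simp
  rw [this]
  field_simp

/-! ### The velocity of the Lagrangian projection -/

/-- The derivative of the Lagrangian projection `(x, y)` of a curve, as a complex number. -/
noncomputable def lagVelocity (γ : ℝ → ℝ × ℝ × ℝ) (s : ℝ) : ℂ :=
  (deriv γ s).1 + (deriv γ s).2.1 * Complex.I

namespace IsLegendrianLoop

variable {γ : ℝ → ℝ × ℝ × ℝ}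

theorem hasDerivAt (h : IsLegendrianLoop γ) (s : ℝ) : HasDerivAt γ (deriv γ s) s :=
  (h.smooth.differentiable (by simp) s).hasDerivAt

theorem hasDerivAt_fst (h : IsLegendrianLoop γ) (s : ℝ) :
    HasDerivAt (fun t => (γ t).1) (deriv γ s).1 s :=
  (h.hasDerivAt s).fst

theorem hasDerivAt_snd_fst (h : IsLegendrianLoop γ) (s : ℝ) :
    HasDerivAt (fun t => (γ t).2.1) (deriv γ s).2.1 s :=
  (h.hasDerivAt s).snd.fst

theorem hasDerivAt_snd_snd (h : IsLegendrianLoop γ) (s : ℝ) :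
    HasDerivAt (fun t => (γ t).2.2) (deriv γ s).2.2 s :=
  (h.hasDerivAt s).snd.snd

theorem lagVelocity_ne_zero (h : IsLegendrianLoop γ) (s : ℝ) : lagVelocity γ s ≠ 0 := by
  intro h0
  have h1 : (deriv γ s).1 = 0 := by simpa [lagVelocity] using congrArg Complex.re h0
  have h2 : (deriv γ s).2.1 = 0 := by simpa [lagVelocity] using congrArg Complex.im h0
  have h3 := h.tangent s
  rw [(h.hasDerivAt_snd_snd s).deriv, (h.hasDerivAt_fst s).deriv, h1, mul_zero] at h3
  exact h.immersed s (Prod.ext h1 (Prod.ext h2 h3))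

theorem contDiff_deriv (h : IsLegendrianLoop γ) : ContDiff ℝ ∞ (deriv γ) :=
  (contDiff_infty_iff_deriv.1 h.smooth).2

theorem contDiff_lagVelocity (h : IsLegendrianLoop γ) : ContDiff ℝ ∞ (lagVelocity γ) := by
  have h1 := h.contDiff_deriv
  exact (Complex.ofRealCLM.contDiff.comp h1.fst).add
    ((Complex.ofRealCLM.contDiff.comp h1.snd.fst).mul contDiff_const)

theorem periodic_deriv (h : IsLegendrianLoop γ) : Function.Periodic (deriv γ) 1 := by
  intro s
  rw [← deriv_comp_add_const, funext h.periodic]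

theorem periodic_lagVelocity (h : IsLegendrianLoop γ) :
    Function.Periodic (lagVelocity γ) 1 := fun s => by
  rw [lagVelocity, lagVelocity, h.periodic_deriv]

/-- A smooth angle function for the velocity of a Legendrian loop, and the integral formula for
the rotation number. -/
theorem exists_smooth_angle (h : IsLegendrianLoop γ) {n : ℤ} (hr : HasLegRotationNumber γ n) :
    ((∫ σ in (0:ℝ)..1, deriv (lagVelocity γ) σ / lagVelocity γ σ).im = 2 * Real.pi * n) ∧
    ∃ θ : ℝ → ℝ, ContDiff ℝ ∞ θ ∧ (∀ s, θ (s + 1) = θ s + 2 * Real.pi * n) ∧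
      ∀ s, ∃ r > 0, (deriv γ s).1 = r * Real.cos (θ s) ∧ (deriv γ s).2.1 = r * Real.sin (θ s) := by
  obtain ⟨θ, hθ, hang, hn⟩ := hr
  have hu := h.contDiff_lagVelocity
  have hu1 : ContDiff ℝ 1 (lagVelocity γ) := hu.of_le (by exact_mod_cast le_top)
  have h0 := h.lagVelocity_ne_zero
  have hnorm : ∀ s, ‖lagVelocity γ s‖ = √((deriv γ s).1 ^ 2 + (deriv γ s).2.1 ^ 2) :=
    fun s => Complex.norm_add_mul_I _ _
  simp only [(h.hasDerivAt_fst _).deriv, (h.hasDerivAt_snd_fst _).deriv, ← hnorm] at hang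
  have hang' : ∀ s, lagVelocity γ s = ‖lagVelocity γ s‖ * Complex.exp (θ s * Complex.I) := by
    intro s
    conv_lhs => rw [lagVelocity, (hang s).1, (hang s).2]
    rw [Complex.exp_mul_I]
    push_cast
    ring
  have hlift := angle_sub_eq_integral hu1 h0 hθ hang'
  have hone : (∫ σ in (0:ℝ)..1, deriv (lagVelocity γ) σ / lagVelocity γ σ).im
      = 2 * Real.pi * n := by rw [← hlift 1, hn]
  have hquot : ContDiff ℝ ∞ fun σ => deriv (lagVelocity γ) σ / lagVelocity γ σ := by
    simp only [div_eq_mul_inv]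
    exact (contDiff_infty_iff_deriv.1 hu).2.mul (hu.inv h0)
  refine ⟨hone, θ, ?_, ?_, fun s => ⟨‖lagVelocity γ s‖, norm_pos_iff.2 (h0 s), hang s⟩⟩
  · have hL : ContDiff ℝ ∞
        (fun s => ∫ σ in (0:ℝ)..s, deriv (lagVelocity γ) σ / lagVelocity γ σ) := by
      have hd : ∀ s, HasDerivAt
          (fun s => ∫ σ in (0:ℝ)..s, deriv (lagVelocity γ) σ / lagVelocity γ σ)
          (deriv (lagVelocity γ) s / lagVelocity γ s) s :=
        fun s => (hquot.continuous.integral_hasStrictDerivAt 0 s).hasDerivAt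
      refine contDiff_infty_iff_deriv.2 ⟨fun s => (hd s).differentiableAt, ?_⟩
      rw [funext fun s => (hd s).deriv]
      exact hquot
    have h1 : θ = fun s => θ 0 +
        (∫ σ in (0:ℝ)..s, deriv (lagVelocity γ) σ / lagVelocity γ σ).im := by
      funext s
      rw [← hlift s]
      ring
    rw [h1]
    exact contDiff_const.add (Complex.imCLM.contDiff.comp hL)
  · intro s
    have hper : Function.Periodic
        (fun σ => deriv (lagVelocity γ) σ / lagVelocity γ σ) 1 := by
      intro σ
      simp only
      rw [h.periodic_lagVelocity, ← deriv_comp_add_const, funext h.periodic_lagVelocity]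
    have hii : ∀ a b : ℝ, IntervalIntegrable
        (fun σ => deriv (lagVelocity γ) σ / lagVelocity γ σ) volume a b :=
      fun a b => hquot.continuous.intervalIntegrable a b
    have h1 := hper.intervalIntegral_add_eq s 0
    rw [zero_add] at h1
    have h2 := intervalIntegral.integral_add_adjacent_intervals (hii 0 s) (hii s (s + 1))
    have h3 := congrArg Complex.im h2
    rw [Complex.add_im, h1, hone, ← hlift s, ← hlift (s + 1)] at h3
    linarith

end IsLegendrianLoop

/-- The rotation number is invariant under Legendrian regular homotopy. -/
theorem IsLegendrianRegularHomotopy.rot_eq {H : ℝ → ℝ → ℝ × ℝ × ℝ}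
    (hH : IsLegendrianRegularHomotopy H) {n₀ n₁ : ℤ}
    (hr₀ : HasLegRotationNumber (H 0) n₀) (hr₁ : HasLegRotationNumber (H 1) n₁) : n₀ = n₁ := by
  obtain ⟨hsm, hleg⟩ := hH
  have hT : UniqueDiffOn ℝ (Icc (0:ℝ) 1) := uniqueDiffOn_Icc zero_lt_one
  have hd := hsm.deriv_snd hT
  have hu : ContDiffOn ℝ ∞ (Function.uncurry fun t s => lagVelocity (H t) s)
      (Icc (0:ℝ) 1 ×ˢ univ) :=
    (Complex.ofRealCLM.contDiff.comp_contDiffOn hd.fst).add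
      ((Complex.ofRealCLM.contDiff.comp_contDiffOn hd.snd.fst).mul contDiffOn_const)
  have hu' := hu.deriv_snd hT
  have hquot : ContinuousOn
      (fun p : ℝ × ℝ => deriv (lagVelocity (H p.1)) p.2 / lagVelocity (H p.1) p.2)
      (Icc (0:ℝ) 1 ×ˢ univ) :=
    hu'.continuousOn.div hu.continuousOn
      fun p hp => (hleg p.1 hp.1).lagVelocity_ne_zero p.2
  let P : ℝ → ℝ := fun t => projIcc (0:ℝ) 1 zero_le_one t
  have hP : Continuous P := continuous_subtype_val.comp continuous_projIcc
  have hPm : ∀ t, P t ∈ Icc (0:ℝ) 1 := fun t => (projIcc (0:ℝ) 1 zero_le_one t).2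
  have hW : Continuous fun t => ∫ σ in (0:ℝ)..1,
      deriv (lagVelocity (H (P t))) σ / lagVelocity (H (P t)) σ := by
    refine intervalIntegral.continuous_parametric_intervalIntegral_of_continuous'
      (f := fun t σ => deriv (lagVelocity (H (P t))) σ / lagVelocity (H (P t)) σ) ?_ 0 1
    exact hquot.comp_continuous
      (f := fun p : ℝ × ℝ => (P p.1, p.2)) (by fun_prop) fun p => ⟨hPm _, mem_univ _⟩
  have hcon := eq_of_continuous_of_int_valued
    (f := fun t => (∫ σ in (0:ℝ)..1,
      deriv (lagVelocity (H (P t))) σ / lagVelocity (H (P t)) σ).im / (2 * Real.pi))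
    ((Complex.continuous_im.comp hW).div_const _)
    (fun t => exists_int_integral_logDeriv
      ((hleg _ (hPm t)).contDiff_lagVelocity.of_le (by exact_mod_cast le_top))
      (hleg _ (hPm t)).lagVelocity_ne_zero
      (by simpa using (hleg _ (hPm t)).periodic_lagVelocity 0)) 0 1
  have hP0 : P 0 = 0 := by simp [P]
  have hP1 : P 1 = 1 := by simp [P]
  have h0 := (hleg 0 (by simp)).exists_smooth_angle hr₀
  have h1 := (hleg 1 (by simp)).exists_smooth_angle hr₁
  simp only [hP0, hP1, h0.1, h1.1] at hcon
  have hpi := Real.pi_ne_zero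
  field_simp at hcon
  exact_mod_cast hcon

/-! ### Smooth families of periodic functions -/

/-- A smooth family, parametrized by `t`, of smooth 1-periodic functions of `s`. -/
structure IsPeriodicFamily (f : ℝ → ℝ → ℝ) : Prop where
  smooth : ContDiff ℝ ∞ (Function.uncurry f)
  periodic : ∀ t s, f t (s + 1) = f t s

namespace IsPeriodicFamily

variable {f g : ℝ → ℝ → ℝ}

theorem contDiff_apply (hf : IsPeriodicFamily f) (t : ℝ) : ContDiff ℝ ∞ (f t) :=
  hf.smooth.comp (contDiff_const.prodMk contDiff_id : ContDiff ℝ ∞ fun s : ℝ => (t, s))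

theorem hasDerivAt (hf : IsPeriodicFamily f) (t s : ℝ) : HasDerivAt (f t) (deriv (f t) s) s :=
  ((hf.contDiff_apply t).differentiable (by simp) s).hasDerivAt

theorem deriv_snd (hf : IsPeriodicFamily f) : IsPeriodicFamily fun t s => deriv (f t) s where
  smooth := hf.smooth.deriv_snd
  periodic t s := by rw [← deriv_comp_add_const, funext (hf.periodic t)]

theorem add (hf : IsPeriodicFamily f) (hg : IsPeriodicFamily g) :
    IsPeriodicFamily fun t s => f t s + g t s where
  smooth := hf.smooth.add hg.smooth
  periodic t s := by rw [hf.periodic, hg.periodic]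

theorem mul (hf : IsPeriodicFamily f) (hg : IsPeriodicFamily g) :
    IsPeriodicFamily fun t s => f t s * g t s where
  smooth := hf.smooth.mul hg.smooth
  periodic t s := by rw [hf.periodic, hg.periodic]

theorem of_param {a : ℝ → ℝ} (ha : ContDiff ℝ ∞ a) : IsPeriodicFamily fun t _ => a t where
  smooth := ha.comp contDiff_fst
  periodic _ _ := rfl

theorem of_periodic {a : ℝ → ℝ} (ha : ContDiff ℝ ∞ a) (hp : ∀ s, a (s + 1) = a s) :
    IsPeriodicFamily fun _ s => a s where
  smooth := ha.comp contDiff_snd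
  periodic _ s := hp s

theorem continuous_apply (hf : IsPeriodicFamily f) (t : ℝ) : Continuous (f t) :=
  (hf.contDiff_apply t).continuous

theorem intervalIntegrable (hf : IsPeriodicFamily f) (t a b : ℝ) :
    IntervalIntegrable (f t) volume a b :=
  (hf.continuous_apply t).intervalIntegrable a b

theorem contDiff_integral (hf : IsPeriodicFamily f) :
    ContDiff ℝ ∞ fun t => ∫ s in (0:ℝ)..1, f t s :=
  contDiff_intervalIntegral hf.smooth

theorem exists_bound (hf : IsPeriodicFamily f) :
    ∃ C, ∀ t ∈ Icc (0:ℝ) 1, ∀ s, |f t s| ≤ C := by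
  obtain ⟨C, hC⟩ := ((isCompact_Icc (a := (0:ℝ)) (b := 1)).prod
    (isCompact_Icc (a := (0:ℝ)) (b := 1))).exists_bound_of_continuousOn
      hf.smooth.continuous.continuousOn
  refine ⟨C, fun t ht s => ?_⟩
  obtain ⟨s', hs', h⟩ := Function.Periodic.exists_mem_Ico₀ (hf.periodic t) one_pos s
  rw [h]
  exact hC (t, s') ⟨ht, hs'.1, hs'.2.le⟩

theorem integral_deriv (hf : IsPeriodicFamily f) (t : ℝ) :
    ∫ s in (0:ℝ)..1, deriv (f t) s = 0 := by
  rw [intervalIntegral.integral_eq_sub_of_hasDerivAt (fun s _ => hf.hasDerivAt t s)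
    (hf.deriv_snd.intervalIntegrable t 0 1)]
  simpa [sub_eq_zero] using hf.periodic t 0

theorem integral_mul_deriv (hf : IsPeriodicFamily f) (hg : IsPeriodicFamily g) (t : ℝ) :
    ∫ s in (0:ℝ)..1, f t s * deriv (g t) s = -∫ s in (0:ℝ)..1, deriv (f t) s * g t s := by
  have h := (hf.mul hg).integral_deriv t
  have h1 : ∀ s, deriv (fun s => f t s * g t s) s
      = deriv (f t) s * g t s + f t s * deriv (g t) s :=
    fun s => ((hf.hasDerivAt t s).mul (hg.hasDerivAt t s)).deriv
  simp only [h1] at h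
  rw [intervalIntegral.integral_add ((hf.deriv_snd.mul hg).intervalIntegrable t 0 1)
    ((hf.mul hg.deriv_snd).intervalIntegrable t 0 1)] at h
  linarith

end IsPeriodicFamily

theorem abs_integral_unit_le {f : ℝ → ℝ} {C : ℝ} (h : ∀ s, |f s| ≤ C) :
    |∫ s in (0:ℝ)..1, f s| ≤ C := by
  simpa using intervalIntegral.norm_integral_le_of_norm_le_const (a := 0) (b := 1)
    (f := f) (C := C) fun s _ => h s

/-! ### Legendrian lifts of families of plane curves -/

/-- The Legendrian lift of a family of immersed closed plane curves `(x, w + f v)` of vanishing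
signed area is a Legendrian regular homotopy. -/
theorem isLegendrianRegularHomotopy_lift {x w v : ℝ → ℝ → ℝ} {f ζ : ℝ → ℝ}
    (hx : IsPeriodicFamily x) (hw : IsPeriodicFamily w) (hv : IsPeriodicFamily v)
    (hf : ContDiffOn ℝ ∞ f (Icc 0 1)) (hζ : ContDiff ℝ ∞ ζ)
    (harea : ∀ t ∈ Icc (0:ℝ) 1, ∫ s in (0:ℝ)..1, (w t s + f t * v t s) * deriv (x t) s = 0)
    (himm : ∀ t ∈ Icc (0:ℝ) 1, ∀ s, deriv (x t) s = 0 →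
      deriv (w t) s + f t * deriv (v t) s ≠ 0) :
    IsLegendrianRegularHomotopy fun t s => (x t s, w t s + f t * v t s,
      ζ t + ∫ σ in (0:ℝ)..s, (w t σ + f t * v t σ) * deriv (x t) σ) := by
  have hsplit : ∀ t s, ∫ σ in (0:ℝ)..s, (w t σ + f t * v t σ) * deriv (x t) σ =
      (∫ σ in (0:ℝ)..s, w t σ * deriv (x t) σ) +
        f t * ∫ σ in (0:ℝ)..s, v t σ * deriv (x t) σ := by
    intro t s
    rw [← intervalIntegral.integral_const_mul, ← intervalIntegral.integral_add
      ((hw.mul hx.deriv_snd).intervalIntegrable t 0 s)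
      (((hv.mul hx.deriv_snd).intervalIntegrable t 0 s).const_mul _)]
    congr 1
    funext σ
    ring
  have hfp : ContDiffOn ℝ ∞ (fun p : ℝ × ℝ => f p.1) (Icc (0:ℝ) 1 ×ˢ univ) :=
    hf.comp contDiffOn_fst fun p hp => hp.1
  have hW := contDiff_primitive (hw.mul hx.deriv_snd).smooth
  have hV := contDiff_primitive (hv.mul hx.deriv_snd).smooth
  have hsmooth : ContDiffOn ℝ ∞ (Function.uncurry fun t s => (x t s, w t s + f t * v t s,
      ζ t + ∫ σ in (0:ℝ)..s, (w t σ + f t * v t σ) * deriv (x t) σ))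
      (Icc (0:ℝ) 1 ×ˢ univ) := by
    simp only [hsplit]
    exact hx.smooth.contDiffOn.prodMk ((hw.smooth.contDiffOn.add
      (hfp.mul hv.smooth.contDiffOn)).prodMk ((hζ.comp contDiff_fst).contDiffOn.add
        (hW.contDiffOn.add (hfp.mul hV.contDiffOn))))
  refine ⟨hsmooth, fun t ht => ?_⟩
  have hy : IsPeriodicFamily fun τ s => w τ s + f t * v τ s :=
    hw.add ((IsPeriodicFamily.of_param contDiff_const).mul hv)
  have hyx := hy.mul hx.deriv_snd
  have hdz : ∀ s, HasDerivAt
      (fun s => ζ t + ∫ σ in (0:ℝ)..s, (w t σ + f t * v t σ) * deriv (x t) σ)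
      ((w t s + f t * v t s) * deriv (x t) s) s := fun s =>
    (((hyx.continuous_apply t).integral_hasStrictDerivAt 0 s).hasDerivAt).const_add _
  have hdy : ∀ s, HasDerivAt (fun s => w t s + f t * v t s)
      (deriv (w t) s + f t * deriv (v t) s) s := fun s =>
    (hw.hasDerivAt t s).add ((hv.hasDerivAt t s).const_mul _)
  refine ⟨?_, ?_, ?_, ?_⟩
  · rw [← contDiffOn_univ]
    exact hsmooth.comp (contDiff_const.prodMk contDiff_id :
      ContDiff ℝ ∞ fun s : ℝ => (t, s)).contDiffOn fun s _ => ⟨ht, mem_univ _⟩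
  · intro s
    have hz : ∫ σ in (0:ℝ)..(s + 1), (w t σ + f t * v t σ) * deriv (x t) σ =
        ∫ σ in (0:ℝ)..s, (w t σ + f t * v t σ) * deriv (x t) σ := by
      have h0 : Function.Periodic (fun σ => (w t σ + f t * v t σ) * deriv (x t) σ) 1 :=
        hyx.periodic t
      have h1 := h0.intervalIntegral_add_eq s 0
      rw [zero_add, harea t ht] at h1
      rw [← intervalIntegral.integral_add_adjacent_intervals
        (hyx.intervalIntegrable t 0 s) (hyx.intervalIntegrable t s (s + 1)), h1, add_zero]
    simp only [hz, hx.periodic, hw.periodic, hv.periodic]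
  · intro s h0
    have hd := (hx.hasDerivAt t s).prodMk ((hdy s).prodMk (hdz s))
    rw [hd.deriv] at h0
    exact himm t ht s (congrArg Prod.fst h0) (congrArg (fun p => p.2.1) h0)
  · intro s
    exact (hdz s).deriv

/-- Let `(X, Y)` be a family of closed plane curves of vanishing signed area. A `C⁰`-small
perturbation of it that is an immersion in a controlled way, and that vanishes at both ends, can
be corrected to have vanishing signed area, so that it lifts to a Legendrian regular homotopy. -/
theorem exists_homotopy_of_small_perturbation {X Y : ℝ → ℝ → ℝ} {ζ : ℝ → ℝ}
    (hX : IsPeriodicFamily X) (hY : IsPeriodicFamily Y) (hζ : ContDiff ℝ ∞ ζ)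
    (harea : ∀ t ∈ Icc (0:ℝ) 1, ∫ s in (0:ℝ)..1, Y t s * deriv (X t) s = 0)
    (hpos : ∀ t ∈ Icc (0:ℝ) 1, 0 < ∫ s in (0:ℝ)..1, deriv (X t) s * deriv (X t) s)
    {C δ : ℝ} (hC : 0 ≤ C) (hδ : 0 < δ) :
    ∃ ε > 0, ∀ p q : ℝ → ℝ → ℝ, IsPeriodicFamily p → IsPeriodicFamily q →
      (∀ t ∈ Icc (0:ℝ) 1, ∀ s, |p t s| ≤ ε) → (∀ t ∈ Icc (0:ℝ) 1, ∀ s, |q t s| ≤ ε) →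
      (∀ t ∈ Icc (0:ℝ) 1, ∀ s, |deriv (p t) s| ≤ C) →
      (∀ t ∈ Icc (0:ℝ) 1, ∀ s,
        δ ≤ |deriv (X t) s + deriv (p t) s| + |deriv (Y t) s + deriv (q t) s|) →
      (p 0 = 0 ∧ q 0 = 0) → (p 1 = 0 ∧ q 1 = 0) →
      ∃ H : ℝ → ℝ → ℝ × ℝ × ℝ, IsLegendrianRegularHomotopy H ∧
        ∀ t, t = 0 ∨ t = 1 → ∀ s,
          H t s = (X t s, Y t s, ζ t + ∫ σ in (0:ℝ)..s, Y t σ * deriv (X t) σ) := by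
  obtain ⟨K₁, hK₁⟩ := hX.deriv_snd.exists_bound
  obtain ⟨K₂, hK₂⟩ := hX.deriv_snd.deriv_snd.exists_bound
  obtain ⟨K₃, hK₃⟩ := hY.deriv_snd.exists_bound
  obtain ⟨K, hK, hKle⟩ : ∃ K ≥ (1:ℝ), K₁ ≤ K ∧ K₂ ≤ K ∧ K₃ ≤ K :=
    ⟨max 1 (max K₁ (max K₂ K₃)), by simp⟩
  replace hK₁ := fun t ht s => (hK₁ t ht s).trans hKle.1
  replace hK₂ := fun t ht s => (hK₂ t ht s).trans hKle.2.1
  replace hK₃ := fun t ht s => (hK₃ t ht s).trans hKle.2.2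
  obtain ⟨t₀, ht₀, hmin⟩ := (isCompact_Icc (a := (0:ℝ)) (b := 1)).exists_isMinOn
    ⟨0, by simp⟩ (hX.deriv_snd.mul hX.deriv_snd).contDiff_integral.continuous.continuousOn
  set m := ∫ s in (0:ℝ)..1, deriv (X t₀) s * deriv (X t₀) s with hm
  have hm0 : 0 < m := hpos t₀ ht₀
  have hmle : ∀ t ∈ Icc (0:ℝ) 1, m ≤ ∫ s in (0:ℝ)..1, deriv (X t) s * deriv (X t) s :=
    fun t ht => hmin ht
  have hK0 : 0 < K := by linarith
  refine ⟨min (m / (2 * K)) (m * δ / (4 * (K * (2 * K + C)))), by positivity, ?_⟩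
  intro p q hp hq hpε hqε hpC hnd h0 h1
  set ε := min (m / (2 * K)) (m * δ / (4 * (K * (2 * K + C)))) with hε
  have hε0 : 0 < ε := by positivity
  have hε1 : ε * K ≤ m / 2 := by
    calc ε * K ≤ m / (2 * K) * K := by gcongr; exact min_le_left _ _
      _ = m / 2 := by field_simp
  have hε2 : 2 * (ε * (2 * K + C)) * K ≤ m * (δ / 2) := by
    calc 2 * (ε * (2 * K + C)) * K = ε * (2 * (2 * K + C) * K) := by ring
      _ ≤ m * δ / (4 * (K * (2 * K + C))) * (2 * (2 * K + C) * K) := by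
        gcongr; exact min_le_right _ _
      _ = m * (δ / 2) := by field_simp; ring
  have hx : IsPeriodicFamily fun t s => X t s + p t s := hX.add hp
  have hw : IsPeriodicFamily fun t s => Y t s + q t s := hY.add hq
  have hdx : ∀ t s, deriv (fun s => X t s + p t s) s = deriv (X t) s + deriv (p t) s :=
    fun t s => ((hX.hasDerivAt t s).add (hp.hasDerivAt t s)).deriv
  have hdw : ∀ t s, deriv (fun s => Y t s + q t s) s = deriv (Y t) s + deriv (q t) s :=
    fun t s => ((hY.hasDerivAt t s).add (hq.hasDerivAt t s)).deriv
  let num : ℝ → ℝ := fun t =>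
    ∫ s in (0:ℝ)..1, (Y t s + q t s) * deriv (fun s => X t s + p t s) s
  let den : ℝ → ℝ := fun t =>
    ∫ s in (0:ℝ)..1, deriv (X t) s * deriv (fun s => X t s + p t s) s
  have hnum : ContDiff ℝ ∞ num := (hw.mul hx.deriv_snd).contDiff_integral
  have hden : ContDiff ℝ ∞ den := (hX.deriv_snd.mul hx.deriv_snd).contDiff_integral
  have hden_ge : ∀ t ∈ Icc (0:ℝ) 1, m / 2 ≤ den t := by
    intro t ht
    have e1 : den t = (∫ s in (0:ℝ)..1, deriv (X t) s * deriv (X t) s) -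
        ∫ s in (0:ℝ)..1, deriv (fun s => deriv (X t) s) s * p t s := by
      rw [sub_eq_add_neg, ← hX.deriv_snd.integral_mul_deriv hp,
        ← intervalIntegral.integral_add
          ((hX.deriv_snd.mul hX.deriv_snd).intervalIntegrable t 0 1)
          ((hX.deriv_snd.mul hp.deriv_snd).intervalIntegrable t 0 1)]
      simp only [den, hdx, mul_add]
    have e2 : |∫ s in (0:ℝ)..1, deriv (fun s => deriv (X t) s) s * p t s| ≤ K * ε :=
      abs_integral_unit_le fun s => by
        rw [abs_mul]
        exact mul_le_mul (hK₂ t ht s) (hpε t ht s) (abs_nonneg _) hK0.le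
    have := hmle t ht
    have := (abs_le.1 e2).2
    rw [e1]
    linarith
  have hnum_le : ∀ t ∈ Icc (0:ℝ) 1, |num t| ≤ ε * (2 * K + C) := by
    intro t ht
    have e1 : num t = (∫ s in (0:ℝ)..1, q t s * deriv (X t) s) +
        (∫ s in (0:ℝ)..1, q t s * deriv (p t) s) -
        ∫ s in (0:ℝ)..1, deriv (Y t) s * p t s := by
      have e0 : num t = (∫ s in (0:ℝ)..1, q t s * deriv (X t) s) +
          (∫ s in (0:ℝ)..1, q t s * deriv (p t) s) +
          (∫ s in (0:ℝ)..1, Y t s * deriv (p t) s) +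
          ∫ s in (0:ℝ)..1, Y t s * deriv (X t) s := by
        rw [← intervalIntegral.integral_add ((hq.mul hX.deriv_snd).intervalIntegrable t 0 1)
            ((hq.mul hp.deriv_snd).intervalIntegrable t 0 1),
          ← intervalIntegral.integral_add
            (((hq.mul hX.deriv_snd).add (hq.mul hp.deriv_snd)).intervalIntegrable t 0 1)
            ((hY.mul hp.deriv_snd).intervalIntegrable t 0 1),
          ← intervalIntegral.integral_add ((((hq.mul hX.deriv_snd).add (hq.mul hp.deriv_snd)).add
              (hY.mul hp.deriv_snd)).intervalIntegrable t 0 1)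
            ((hY.mul hX.deriv_snd).intervalIntegrable t 0 1)]
        simp only [num, hdx]
        congr 1
        funext s
        ring
      rw [e0, hY.integral_mul_deriv hp, harea t ht]
      ring
    have e2 : |∫ s in (0:ℝ)..1, q t s * deriv (X t) s| ≤ ε * K :=
      abs_integral_unit_le fun s => by
        rw [abs_mul]
        exact mul_le_mul (hqε t ht s) (hK₁ t ht s) (abs_nonneg _) hε0.le
    have e3 : |∫ s in (0:ℝ)..1, q t s * deriv (p t) s| ≤ ε * C :=
      abs_integral_unit_le fun s => by
        rw [abs_mul]
        exact mul_le_mul (hqε t ht s) (hpC t ht s) (abs_nonneg _) hε0.le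
    have e4 : |∫ s in (0:ℝ)..1, deriv (Y t) s * p t s| ≤ K * ε :=
      abs_integral_unit_le fun s => by
        rw [abs_mul]
        exact mul_le_mul (hK₃ t ht s) (hpε t ht s) (abs_nonneg _) hK0.le
    rw [abs_le] at *
    rw [e1]
    constructor <;> nlinarith
  have hden0 : ∀ t ∈ Icc (0:ℝ) 1, 0 < den t := fun t ht => by
    have := hden_ge t ht
    linarith
  refine ⟨_, isLegendrianRegularHomotopy_lift (f := fun t => -num t / den t) hx hw hX.deriv_snd
    (hnum.neg.contDiffOn.div hden.contDiffOn fun t ht => (hden0 t ht).ne') hζ ?_ ?_, ?_⟩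
  · intro t ht
    have e1 : ∫ s in (0:ℝ)..1, (Y t s + q t s + -num t / den t * deriv (X t) s) *
        deriv (fun s => X t s + p t s) s = num t + -num t / den t * den t := by
      rw [← intervalIntegral.integral_const_mul, ← intervalIntegral.integral_add
        ((hw.mul hx.deriv_snd).intervalIntegrable t 0 1)
        (((hX.deriv_snd.mul hx.deriv_snd).intervalIntegrable t 0 1).const_mul _)]
      congr 1
      funext s
      ring
    rw [e1, div_mul_cancel₀ _ (hden0 t ht).ne']
    ring
  · intro t ht s hx0 hy0
    have hd := hnd t ht s
    rw [hdx] at hx0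
    rw [hdw] at hy0
    have e1 : |-num t / den t| * K ≤ δ / 2 := by
      rw [abs_div, abs_neg, abs_of_pos (hden0 t ht), div_mul_eq_mul_div, div_le_iff₀ (hden0 t ht)]
      have e2 := mul_le_mul_of_nonneg_right (hnum_le t ht) hK0.le
      have e3 := mul_le_mul_of_nonneg_left (hden_ge t ht) (half_pos hδ).le
      nlinarith
    have e2 : deriv (Y t) s + deriv (q t) s =
        -(-num t / den t * deriv (fun s => deriv (X t) s) s) := by linarith
    rw [hx0, e2, abs_zero, zero_add, abs_neg, abs_mul] at hd
    have e3 := mul_le_mul_of_nonneg_left (hK₂ t ht s) (abs_nonneg (-num t / den t))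
    linarith
  · intro t ht s
    have hpq : p t = 0 ∧ q t = 0 := by rcases ht with rfl | rfl <;> assumption
    have htI : t ∈ Icc (0:ℝ) 1 := by rcases ht with rfl | rfl <;> simp
    have hnum0 : num t = 0 := by
      simpa [num, hpq.1, hpq.2] using harea t htI
    simp [hnum0, hpq.1, hpq.2]

/-! ### Adding rapid figure-eight oscillations -/

/-- Let `(X, Y)` be a family of closed plane curves of vanishing signed area. If adding to its
velocity the figure-eight loop `(cos 4πτ, sin 2πτ)`, multiplied by the complex number
`ρ (c + i d)`, never gives zero, then a rapidly oscillating perturbation of the family lifts to a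
Legendrian regular homotopy. -/
theorem exists_homotopy_of_oscillation {X Y c d : ℝ → ℝ → ℝ} {ρ ζ : ℝ → ℝ}
    (hX : IsPeriodicFamily X) (hY : IsPeriodicFamily Y)
    (hc : IsPeriodicFamily c) (hd : IsPeriodicFamily d)
    (hρ : ContDiff ℝ ∞ ρ) (hρ0 : ρ 0 = 0) (hρ1 : ρ 1 = 0) (hζ : ContDiff ℝ ∞ ζ)
    (harea : ∀ t ∈ Icc (0:ℝ) 1, ∫ s in (0:ℝ)..1, Y t s * deriv (X t) s = 0)
    (hpos : ∀ t ∈ Icc (0:ℝ) 1, 0 < ∫ s in (0:ℝ)..1, deriv (X t) s * deriv (X t) s)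
    (hnd : ∀ t ∈ Icc (0:ℝ) 1, ∀ s τ,
      deriv (X t) s + ρ t * (c t s * Real.cos (4 * Real.pi * τ)
        - d t s * Real.sin (2 * Real.pi * τ)) = 0 →
      deriv (Y t) s + ρ t * (d t s * Real.cos (4 * Real.pi * τ)
        + c t s * Real.sin (2 * Real.pi * τ)) ≠ 0) :
    ∃ H : ℝ → ℝ → ℝ × ℝ × ℝ, IsLegendrianRegularHomotopy H ∧
      ∀ t, t = 0 ∨ t = 1 → ∀ s,
        H t s = (X t s, Y t s, ζ t + ∫ σ in (0:ℝ)..s, Y t σ * deriv (X t) σ) := by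
  have hpi := Real.pi_pos
  have hρf : IsPeriodicFamily fun t _ => ρ t := .of_param hρ
  obtain ⟨K₁, hK₁⟩ := (hρf.mul hc).exists_bound
  obtain ⟨K₂, hK₂⟩ := (hρf.mul hd).exists_bound
  obtain ⟨K₃, hK₃⟩ := (hρf.mul hc.deriv_snd).exists_bound
  obtain ⟨K₄, hK₄⟩ := (hρf.mul hd.deriv_snd).exists_bound
  obtain ⟨K, hK, hKle⟩ : ∃ K > (0:ℝ), K₁ ≤ K ∧ K₂ ≤ K ∧ K₃ ≤ K ∧ K₄ ≤ K :=
    ⟨max 1 (max K₁ (max K₂ (max K₃ K₄))), lt_max_of_lt_left one_pos, by simp⟩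
  replace hK₁ := fun t ht s => (hK₁ t ht s).trans hKle.1
  replace hK₂ := fun t ht s => (hK₂ t ht s).trans hKle.2.1
  replace hK₃ := fun t ht s => (hK₃ t ht s).trans hKle.2.2.1
  replace hK₄ := fun t ht s => (hK₄ t ht s).trans hKle.2.2.2
  -- a uniform lower bound for the perturbed velocity
  let G : ℝ × ℝ × ℝ → ℝ := fun a =>
    |deriv (X a.1) a.2.1 + ρ a.1 * (c a.1 a.2.1 * Real.cos (4 * Real.pi * a.2.2)
        - d a.1 a.2.1 * Real.sin (2 * Real.pi * a.2.2))| +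
    |deriv (Y a.1) a.2.1 + ρ a.1 * (d a.1 a.2.1 * Real.cos (4 * Real.pi * a.2.2)
        + c a.1 a.2.1 * Real.sin (2 * Real.pi * a.2.2))|
  have hpair : Continuous fun a : ℝ × ℝ × ℝ => (a.1, a.2.1) := by fun_prop
  have hXc : Continuous fun a : ℝ × ℝ × ℝ => deriv (X a.1) a.2.1 :=
    hX.deriv_snd.smooth.continuous.comp hpair
  have hYc : Continuous fun a : ℝ × ℝ × ℝ => deriv (Y a.1) a.2.1 :=
    hY.deriv_snd.smooth.continuous.comp hpair
  have hcc : Continuous fun a : ℝ × ℝ × ℝ => c a.1 a.2.1 := hc.smooth.continuous.comp hpair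
  have hdc : Continuous fun a : ℝ × ℝ × ℝ => d a.1 a.2.1 := hd.smooth.continuous.comp hpair
  have hρc : Continuous fun a : ℝ × ℝ × ℝ => ρ a.1 := hρ.continuous.comp continuous_fst
  have hcosc : Continuous fun a : ℝ × ℝ × ℝ => Real.cos (4 * Real.pi * a.2.2) := by fun_prop
  have hsinc : Continuous fun a : ℝ × ℝ × ℝ => Real.sin (2 * Real.pi * a.2.2) := by fun_prop
  have hG : Continuous G :=
    (hXc.add (hρc.mul ((hcc.mul hcosc).sub (hdc.mul hsinc)))).abs.add
      (hYc.add (hρc.mul ((hdc.mul hcosc).add (hcc.mul hsinc)))).abs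
  obtain ⟨δ, hδ, hGδ⟩ : ∃ δ > 0, ∀ t ∈ Icc (0:ℝ) 1, ∀ s τ, δ ≤ G (t, s, τ) := by
    obtain ⟨a, ha, hmin⟩ := ((isCompact_Icc (a := (0:ℝ)) (b := 1)).prod
      ((isCompact_Icc (a := (0:ℝ)) (b := 1)).prod
        (isCompact_Icc (a := (0:ℝ)) (b := 1)))).exists_isMinOn
      ⟨(0, 0, 0), by simp⟩ hG.continuousOn
    refine ⟨G a, ?_, fun t ht s τ => ?_⟩
    · by_cases h : deriv (X a.1) a.2.1 + ρ a.1 * (c a.1 a.2.1 * Real.cos (4 * Real.pi * a.2.2)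
        - d a.1 a.2.1 * Real.sin (2 * Real.pi * a.2.2)) = 0
      · exact add_pos_of_nonneg_of_pos (abs_nonneg _)
          (abs_pos.2 (hnd a.1 ha.1 a.2.1 a.2.2 h))
      · exact add_pos_of_pos_of_nonneg (abs_pos.2 h) (abs_nonneg _)
    · have hps : Function.Periodic (fun s => G (t, s, τ)) 1 := fun s => by
        simp only [G, hX.deriv_snd.periodic, hY.deriv_snd.periodic, hc.periodic, hd.periodic]
      obtain ⟨s', hs', hs⟩ := hps.exists_mem_Ico₀ one_pos s
      have hpτ : Function.Periodic (fun τ => G (t, s', τ)) 1 := fun τ => by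
        have e1 : 4 * Real.pi * (τ + 1) = 4 * Real.pi * τ + (2 : ℕ) * (2 * Real.pi) := by
          push_cast
          ring
        have e2 : 2 * Real.pi * (τ + 1) = 2 * Real.pi * τ + 2 * Real.pi := by ring
        simp only [G, e1, e2, Real.cos_add_nat_mul_two_pi, Real.sin_add_two_pi]
      obtain ⟨τ', hτ', hτ⟩ := hpτ.exists_mem_Ico₀ one_pos τ
      rw [show G (t, s, τ) = G (t, s', τ') from hs.trans hτ]
      exact hmin ⟨ht, ⟨hs'.1, hs'.2.le⟩, hτ'.1, hτ'.2.le⟩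
  obtain ⟨ε, hε, hmain⟩ := exists_homotopy_of_small_perturbation hX hY hζ harea hpos
    (C := 4 * K) (δ := δ / 2) (by positivity) (by positivity)
  obtain ⟨N, hN⟩ := exists_nat_gt (max 1 (max (2 * K / ε) (4 * K / (δ / 2))))
  rw [max_lt_iff, max_lt_iff, div_lt_iff₀ hε, div_lt_iff₀ (half_pos hδ)] at hN
  obtain ⟨hN1, hNε, hNδ⟩ := hN
  have hN0 : (0:ℝ) < N := by linarith
  -- the two components of the oscillation and their bounds
  let a : ℝ → ℝ := fun s => Real.sin (4 * Real.pi * (N * s)) / (4 * Real.pi * N)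
  let b : ℝ → ℝ := fun s => -Real.cos (2 * Real.pi * (N * s)) / (2 * Real.pi * N)
  have ha : IsPeriodicFamily fun _ s => a s := by
    refine .of_periodic (by fun_prop) fun s => ?_
    have e1 : 4 * Real.pi * (N * (s + 1)) =
        4 * Real.pi * (N * s) + (2 * N : ℕ) * (2 * Real.pi) := by
      push_cast
      ring
    simp only [a, e1, Real.sin_add_nat_mul_two_pi]
  have hb : IsPeriodicFamily fun _ s => b s := by
    refine .of_periodic (by fun_prop) fun s => ?_
    have e1 : 2 * Real.pi * (N * (s + 1)) =
        2 * Real.pi * (N * s) + (N : ℕ) * (2 * Real.pi) := by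
      ring
    simp only [b, e1, Real.cos_add_nat_mul_two_pi]
  have hda : ∀ s, HasDerivAt a (Real.cos (4 * Real.pi * (N * s))) s := by
    intro s
    have := (((((hasDerivAt_id s).const_mul (N:ℝ)).const_mul (4 * Real.pi)).sin).div_const
      (4 * Real.pi * N))
    refine this.congr_deriv ?_
    simp only [id]
    field_simp
  have hdb : ∀ s, HasDerivAt b (Real.sin (2 * Real.pi * (N * s))) s := by
    intro s
    have := (((((hasDerivAt_id s).const_mul (N:ℝ)).const_mul (2 * Real.pi)).cos).neg.div_const
      (2 * Real.pi * N))
    refine this.congr_deriv ?_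
    simp only [id]
    field_simp
  have hab : ∀ s, |a s| ≤ 1 / N := by
    intro s
    rw [abs_div, abs_of_pos (by positivity : 0 < 4 * Real.pi * N)]
    exact div_le_div₀ zero_le_one (Real.abs_sin_le_one _) hN0
      (by nlinarith [Real.pi_gt_three])
  have hbb : ∀ s, |b s| ≤ 1 / N := by
    intro s
    rw [abs_div, abs_neg, abs_of_pos (by positivity : 0 < 2 * Real.pi * N)]
    exact div_le_div₀ zero_le_one (Real.abs_cos_le_one _) hN0
      (by nlinarith [Real.pi_gt_three])
  have hbound : ∀ {u v α β M : ℝ}, |u| ≤ K → |v| ≤ K → |α| ≤ M → |β| ≤ M →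
      |u * α| + |v * β| ≤ 2 * K * M := by
    intro u v α β M hu hv hα hβ
    rw [abs_mul, abs_mul]
    have := mul_le_mul hu hα (abs_nonneg _) hK.le
    have := mul_le_mul hv hβ (abs_nonneg _) hK.le
    linarith
  have hKε : 2 * K * (1 / N) ≤ ε := by
    rw [mul_one_div, div_le_iff₀ hN0]
    linarith
  have hKδ : 2 * K * (1 / N) ≤ δ / 4 := by
    rw [mul_one_div, div_le_iff₀ hN0]
    linarith
  have hK1 : 2 * K * (1 / N) ≤ 2 * K := by
    rw [mul_one_div, div_le_iff₀ hN0]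
    nlinarith
  have hp := (hρf.mul hc).mul ha |>.add ((((hρf.mul hd).mul hb)).mul (.of_param contDiff_const
    (a := fun _ => -1)))
  have hq := (hρf.mul hd).mul ha |>.add ((hρf.mul hc).mul hb)
  have hdp : ∀ t s, deriv (fun s => ρ t * c t s * a s + ρ t * d t s * b s * (-1)) s =
      ρ t * (c t s * Real.cos (4 * Real.pi * (N * s))
        - d t s * Real.sin (2 * Real.pi * (N * s))) +
      (ρ t * deriv (c t) s * a s - ρ t * deriv (d t) s * b s) := by
    intro t s
    have := ((((hc.hasDerivAt t s).const_mul (ρ t)).mul (hda s)).add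
      ((((hd.hasDerivAt t s).const_mul (ρ t)).mul (hdb s)).mul_const (-1))).deriv
    refine this.trans ?_
    ring
  have hdq : ∀ t s, deriv (fun s => ρ t * d t s * a s + ρ t * c t s * b s) s =
      ρ t * (d t s * Real.cos (4 * Real.pi * (N * s))
        + c t s * Real.sin (2 * Real.pi * (N * s))) +
      (ρ t * deriv (d t) s * a s + ρ t * deriv (c t) s * b s) := by
    intro t s
    have := ((((hd.hasDerivAt t s).const_mul (ρ t)).mul (hda s)).add
      (((hc.hasDerivAt t s).const_mul (ρ t)).mul (hdb s))).deriv
    refine this.trans ?_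
    ring
  refine hmain _ _ hp hq ?_ ?_ ?_ ?_ ?_ ?_
  · intro t ht s
    refine (abs_add_le _ _).trans ?_
    rw [abs_mul _ (-1), abs_neg, abs_one, mul_one]
    exact (hbound (hK₁ t ht s) (hK₂ t ht s) (hab s) (hbb s)).trans hKε
  · intro t ht s
    refine (abs_add_le _ _).trans ?_
    exact (hbound (hK₂ t ht s) (hK₁ t ht s) (hab s) (hbb s)).trans hKε
  · intro t ht s
    rw [hdp]
    have e1 := hbound (hK₁ t ht s) (hK₂ t ht s)
      (Real.abs_cos_le_one (4 * Real.pi * (N * s))) (Real.abs_sin_le_one (2 * Real.pi * (N * s)))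
    have e2 := hbound (hK₃ t ht s) (hK₄ t ht s) (hab s) (hbb s)
    have e3 := abs_sub (ρ t * c t s * Real.cos (4 * Real.pi * (N * s)))
      (ρ t * d t s * Real.sin (2 * Real.pi * (N * s)))
    have e4 := abs_sub (ρ t * deriv (c t) s * a s) (ρ t * deriv (d t) s * b s)
    have e5 := abs_add_le (ρ t * (c t s * Real.cos (4 * Real.pi * (N * s))
        - d t s * Real.sin (2 * Real.pi * (N * s))))
      (ρ t * deriv (c t) s * a s - ρ t * deriv (d t) s * b s)
    rw [mul_sub, ← mul_assoc (ρ t) (c t s), ← mul_assoc (ρ t) (d t s)] at e5 ⊢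
    linarith
  · intro t ht s
    rw [hdp, hdq, ← add_assoc, ← add_assoc]
    have e1 := hGδ t ht s (N * s)
    have e2 := hbound (hK₃ t ht s) (hK₄ t ht s) (hab s) (hbb s)
    have e3 := hbound (hK₄ t ht s) (hK₃ t ht s) (hab s) (hbb s)
    have e4 := abs_sub (ρ t * deriv (c t) s * a s) (ρ t * deriv (d t) s * b s)
    have e5 := abs_add_le (ρ t * deriv (d t) s * a s) (ρ t * deriv (c t) s * b s)
    have e6 : ∀ A B : ℝ, |A| ≤ |A + B| + |B| := fun A B => by
      simpa using abs_sub (A + B) B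
    have e7 := e6 (deriv (X t) s + ρ t * (c t s * Real.cos (4 * Real.pi * (N * s))
        - d t s * Real.sin (2 * Real.pi * (N * s))))
      (ρ t * deriv (c t) s * a s - ρ t * deriv (d t) s * b s)
    have e8 := e6 (deriv (Y t) s + ρ t * (d t s * Real.cos (4 * Real.pi * (N * s))
        + c t s * Real.sin (2 * Real.pi * (N * s))))
      (ρ t * deriv (d t) s * a s + ρ t * deriv (c t) s * b s)
    simp only [G] at e1
    linarith
  · constructor <;> funext s <;> simp [hρ0]
  · constructor <;> funext s <;> simp [hρ1]

/-! ### Interpolating between two curves -/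

theorem integral_mul_self_pos {f : ℝ → ℝ} (hf : Continuous f) (hp : Function.Periodic f 1)
    {s : ℝ} (hs : f s ≠ 0) : 0 < ∫ σ in (0:ℝ)..1, f σ * f σ := by
  obtain ⟨s', hs', h⟩ := hp.exists_mem_Ico₀ one_pos s
  rw [h] at hs
  exact intervalIntegral.integral_pos zero_lt_one (hf.mul hf).continuousOn
    (fun σ _ => mul_self_nonneg _) ⟨s', ⟨hs'.1, hs'.2.le⟩, mul_self_pos.2 hs⟩

/-- Two closed plane curves of vanishing signed area, whose first coordinates are not constant,
are joined by a family of such curves. -/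
theorem exists_zero_area_family {x₀ y₀ x₁ y₁ : ℝ → ℝ}
    (hx₀ : ContDiff ℝ ∞ x₀) (hy₀ : ContDiff ℝ ∞ y₀)
    (hx₁ : ContDiff ℝ ∞ x₁) (hy₁ : ContDiff ℝ ∞ y₁)
    (px₀ : ∀ s, x₀ (s + 1) = x₀ s) (py₀ : ∀ s, y₀ (s + 1) = y₀ s)
    (px₁ : ∀ s, x₁ (s + 1) = x₁ s) (py₁ : ∀ s, y₁ (s + 1) = y₁ s)
    (ha₀ : ∫ s in (0:ℝ)..1, y₀ s * deriv x₀ s = 0)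
    (ha₁ : ∫ s in (0:ℝ)..1, y₁ s * deriv x₁ s = 0)
    (hn₀ : ∃ s, deriv x₀ s ≠ 0) (hn₁ : ∃ s, deriv x₁ s ≠ 0)
    {β : ℝ → ℝ} (hβ : ContDiff ℝ ∞ β) (hβm : ∀ t, β t ∈ Icc (0:ℝ) 1) :
    ∃ X Y : ℝ → ℝ → ℝ, IsPeriodicFamily X ∧ IsPeriodicFamily Y ∧
      (∀ t, ∫ s in (0:ℝ)..1, Y t s * deriv (X t) s = 0) ∧
      (∀ t, 0 < ∫ s in (0:ℝ)..1, deriv (X t) s * deriv (X t) s) ∧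
      (∀ t, β t = 0 → X t = x₀ ∧ Y t = y₀) ∧ (∀ t, β t = 1 → X t = x₁ ∧ Y t = y₁) := by
  have fx₀ : IsPeriodicFamily fun _ s => x₀ s := .of_periodic hx₀ px₀
  have fy₀ : IsPeriodicFamily fun _ s => y₀ s := .of_periodic hy₀ py₀
  have fx₁ : IsPeriodicFamily fun _ s => x₁ s := .of_periodic hx₁ px₁
  have fy₁ : IsPeriodicFamily fun _ s => y₁ s := .of_periodic hy₁ py₁
  have fβ : IsPeriodicFamily fun t _ => β t := .of_param hβ
  have fβ' : IsPeriodicFamily fun t _ => 1 - β t := .of_param (contDiff_const.sub hβ)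
  -- the sign of the detour which keeps the first coordinate nonconstant
  obtain ⟨l, hl0, hl⟩ : ∃ l : ℝ, l ≠ 0 ∧
      0 ≤ l * ∫ s in (0:ℝ)..1, deriv x₁ s * deriv (deriv x₀) s := by
    rcases le_total 0 (∫ s in (0:ℝ)..1, deriv x₁ s * deriv (deriv x₀) s) with h | h
    · exact ⟨1, one_ne_zero, by linarith⟩
    · exact ⟨-1, by norm_num, by linarith⟩
  let X : ℝ → ℝ → ℝ := fun t s =>
    (1 - β t) * x₀ s + β t * x₁ s + (β t * (1 - β t) * l) * deriv x₀ s
  have hX : IsPeriodicFamily X :=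
    ((fβ'.mul fx₀).add (fβ.mul fx₁)).add
      (((fβ.mul fβ').mul (.of_param (contDiff_const (c := l)))).mul fx₀.deriv_snd)
  have hdX : ∀ t s, deriv (X t) s = (1 - β t) * deriv x₀ s + β t * deriv x₁ s
      + (β t * (1 - β t) * l) * deriv (deriv x₀) s := fun t s =>
    ((((fx₀.hasDerivAt t s).const_mul _).add ((fx₁.hasDerivAt t s).const_mul _)).add
      ((fx₀.deriv_snd.hasDerivAt t s).const_mul _)).deriv
  have hpos : ∀ t, 0 < ∫ s in (0:ℝ)..1, deriv (X t) s * deriv (X t) s := by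
    intro t
    suffices h : ∃ s, deriv (X t) s ≠ 0 by
      obtain ⟨s, hs⟩ := h
      exact integral_mul_self_pos (hX.deriv_snd.continuous_apply t) (hX.deriv_snd.periodic t) hs
    by_contra! hzero
    by_cases hb0 : β t = 0
    · obtain ⟨s, hs⟩ := hn₀
      have := hzero s
      rw [hdX, hb0] at this
      exact hs (by linarith)
    by_cases hb1 : β t = 1
    · obtain ⟨s, hs⟩ := hn₁
      have := hzero s
      rw [hdX, hb1] at this
      exact hs (by linarith)
    have hβ0 : 0 < β t := lt_of_le_of_ne (hβm t).1 (Ne.symm hb0)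
    have hβ1 : 0 < 1 - β t := sub_pos.2 (lt_of_le_of_ne (hβm t).2 hb1)
    have hdd : ∃ s, deriv (deriv x₀) s ≠ 0 := by
      by_contra! hdd
      obtain ⟨s, hs⟩ := hn₀
      have hcon : ∀ σ, deriv x₀ σ = deriv x₀ s := fun σ =>
        is_const_of_deriv_eq_zero
          ((fx₀.deriv_snd.contDiff_apply 0).differentiable (by simp)) hdd σ s
      have := fx₀.integral_deriv 0
      simp only [hcon, intervalIntegral.integral_const, sub_zero, one_smul] at this
      exact hs this
    obtain ⟨s, hs⟩ := hdd
    have hsq := integral_mul_self_pos (fx₀.deriv_snd.deriv_snd.continuous_apply 0)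
      (fx₀.deriv_snd.deriv_snd.periodic 0) hs
    have horth := fx₀.deriv_snd.integral_mul_deriv fx₀.deriv_snd 0
    have hsum : ∫ s in (0:ℝ)..1, deriv (X t) s * deriv (deriv x₀) s =
        (1 - β t) * (∫ s in (0:ℝ)..1, deriv x₀ s * deriv (deriv x₀) s) +
        β t * (∫ s in (0:ℝ)..1, deriv x₁ s * deriv (deriv x₀) s) +
        (β t * (1 - β t) * l) * ∫ s in (0:ℝ)..1, deriv (deriv x₀) s * deriv (deriv x₀) s := by
      have i₁ := ((fx₀.deriv_snd.mul fx₀.deriv_snd.deriv_snd).intervalIntegrable 0 0 1).const_mul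
        (1 - β t)
      have i₂ := ((fx₁.deriv_snd.mul fx₀.deriv_snd.deriv_snd).intervalIntegrable 0 0 1).const_mul
        (β t)
      have i₃ := ((fx₀.deriv_snd.deriv_snd.mul
        fx₀.deriv_snd.deriv_snd).intervalIntegrable 0 0 1).const_mul (β t * (1 - β t) * l)
      rw [← intervalIntegral.integral_const_mul, ← intervalIntegral.integral_const_mul,
        ← intervalIntegral.integral_const_mul, ← intervalIntegral.integral_add i₁ i₂,
        ← intervalIntegral.integral_add (i₁.add i₂) i₃]
      congr 1
      funext s
      rw [hdX]
      ring
    simp only [hzero, zero_mul, intervalIntegral.integral_zero] at hsum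
    have horth0 : ∫ s in (0:ℝ)..1, deriv x₀ s * deriv (deriv x₀) s = 0 := by
      have : ∫ s in (0:ℝ)..1, deriv (fun s => deriv x₀ s) s * deriv x₀ s =
          ∫ s in (0:ℝ)..1, deriv x₀ s * deriv (deriv x₀) s := by
        simp only [mul_comm]
      rw [this] at horth
      linarith
    rw [horth0] at hsum
    have hlsq : 0 < l * l := mul_self_pos.2 hl0
    have h1 : 0 < β t * (1 - β t) * (l * l) *
        ∫ s in (0:ℝ)..1, deriv (deriv x₀) s * deriv (deriv x₀) s := by positivity
    have h2 : 0 ≤ β t * (l * ∫ s in (0:ℝ)..1, deriv x₁ s * deriv (deriv x₀) s) := by positivity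
    have h3 := congrArg (l * ·) hsum
    nlinarith
  let W : ℝ → ℝ → ℝ := fun t s => (1 - β t) * y₀ s + β t * y₁ s
  have hW : IsPeriodicFamily W := (fβ'.mul fy₀).add (fβ.mul fy₁)
  let f : ℝ → ℝ := fun t => -(∫ s in (0:ℝ)..1, W t s * deriv (X t) s) /
    ∫ s in (0:ℝ)..1, deriv (X t) s * deriv (X t) s
  have hf : ContDiff ℝ ∞ f := (hW.mul hX.deriv_snd).contDiff_integral.neg.div
    (hX.deriv_snd.mul hX.deriv_snd).contDiff_integral fun t => (hpos t).ne'
  have hend : ∀ t (x y : ℝ → ℝ), X t = x → W t = y → ∫ s in (0:ℝ)..1, y s * deriv x s = 0 →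
      X t = x ∧ (fun s => W t s + f t * deriv (X t) s) = y := by
    intro t x y hXx hWy h
    refine ⟨hXx, ?_⟩
    have hf0 : f t = 0 := by simp only [f, hXx, hWy, h, neg_zero, zero_div]
    simp only [hf0, zero_mul, add_zero, ← hWy]
  refine ⟨X, fun t s => W t s + f t * deriv (X t) s, hX,
    hW.add ((IsPeriodicFamily.of_param hf).mul hX.deriv_snd), fun t => ?_, hpos,
    fun t ht => hend t _ _ ?_ ?_ ha₀, fun t ht => hend t _ _ ?_ ?_ ha₁⟩
  · simp only [add_mul, mul_assoc]
    rw [intervalIntegral.integral_add ((hW.mul hX.deriv_snd).intervalIntegrable t 0 1)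
      (((hX.deriv_snd.mul hX.deriv_snd).intervalIntegrable t 0 1).const_mul _),
      intervalIntegral.integral_const_mul]
    simp only [f]
    rw [div_mul_cancel₀ _ (hpos t).ne', add_neg_cancel]
  all_goals
    funext s
    simp [X, W, ht]

/-! ### The main theorem -/

/-- The figure-eight loop `(cos 4πτ, sin 2πτ)` avoids the nonpositive real axis. -/
theorem add_smul_figureEight_ne_zero {r ρ a b : ℝ} (hr : 0 < r) (hρ : 0 ≤ ρ)
    (hab : a ^ 2 + b ^ 2 = 1) (τ : ℝ)
    (h : r * a + ρ * (a * Real.cos (4 * Real.pi * τ) - b * Real.sin (2 * Real.pi * τ)) = 0) :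
    r * b + ρ * (b * Real.cos (4 * Real.pi * τ) + a * Real.sin (2 * Real.pi * τ)) ≠ 0 := by
  intro h'
  have hcos : Real.cos (4 * Real.pi * τ) = 1 - 2 * Real.sin (2 * Real.pi * τ) ^ 2 := by
    rw [show 4 * Real.pi * τ = 2 * (2 * Real.pi * τ) by ring, Real.cos_two_mul, Real.cos_sq']
    ring
  have h1 : r + ρ * Real.cos (4 * Real.pi * τ) = 0 := by
    linear_combination a * h + b * h' - (r + ρ * Real.cos (4 * Real.pi * τ)) * hab
  have h2 : ρ * Real.sin (2 * Real.pi * τ) = 0 := by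
    linear_combination a * h' - b * h - ρ * Real.sin (2 * Real.pi * τ) * hab
  rw [hcos] at h1
  rcases mul_eq_zero.1 h2 with h0 | h0 <;> rw [h0] at h1 <;> linarith

/-- The figure-eight loop `(cos 4πτ, sin 2πτ)` stays away from the origin. -/
theorem add_large_smul_figureEight_ne_zero {u v ρ C a b : ℝ} (hu : |u| ≤ C) (hv : |v| ≤ C)
    (hC : 4 * C < ρ) (hab : a ^ 2 + b ^ 2 = 1) (τ : ℝ)
    (h : u + ρ * (a * Real.cos (4 * Real.pi * τ) - b * Real.sin (2 * Real.pi * τ)) = 0) :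
    v + ρ * (b * Real.cos (4 * Real.pi * τ) + a * Real.sin (2 * Real.pi * τ)) ≠ 0 := by
  intro h'
  have hcos : Real.cos (4 * Real.pi * τ) = 1 - 2 * Real.sin (2 * Real.pi * τ) ^ 2 := by
    rw [show 4 * Real.pi * τ = 2 * (2 * Real.pi * τ) by ring, Real.cos_two_mul, Real.cos_sq']
    ring
  have h1 : u ^ 2 + v ^ 2 = ρ ^ 2 *
      (Real.cos (4 * Real.pi * τ) ^ 2 + Real.sin (2 * Real.pi * τ) ^ 2) := by
    rw [eq_neg_of_add_eq_zero_left h, eq_neg_of_add_eq_zero_left h']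
    linear_combination ρ ^ 2 *
      (Real.cos (4 * Real.pi * τ) ^ 2 + Real.sin (2 * Real.pi * τ) ^ 2) * hab
  have h2 : (1 / 4 : ℝ) ≤ Real.cos (4 * Real.pi * τ) ^ 2 + Real.sin (2 * Real.pi * τ) ^ 2 := by
    rw [hcos]
    nlinarith [sq_nonneg (8 * Real.sin (2 * Real.pi * τ) ^ 2 - 3)]
  have hC0 : 0 ≤ C := (abs_nonneg u).trans hu
  have h3 : u ^ 2 ≤ C ^ 2 := sq_le_sq' (abs_le.1 hu).1 (abs_le.1 hu).2
  have h4 : v ^ 2 ≤ C ^ 2 := sq_le_sq' (abs_le.1 hv).1 (abs_le.1 hv).2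
  have h5 : (4 * C) ^ 2 < ρ ^ 2 := by gcongr
  nlinarith [sq_nonneg ρ]

namespace IsLegendrianLoop

variable {γ : ℝ → ℝ × ℝ × ℝ}

/-- The first coordinate of a Legendrian loop is not constant. -/
theorem exists_deriv_fst_ne_zero (h : IsLegendrianLoop γ) :
    ∃ s, deriv (fun t => (γ t).1) s ≠ 0 := by
  by_contra! h0
  have hper : (γ 0).2.1 = (γ 1).2.1 := by
    have := h.periodic 0
    rw [zero_add] at this
    rw [this]
  obtain ⟨s, -, hs⟩ := exists_deriv_eq_zero (f := fun t => (γ t).2.1) zero_lt_one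
    h.smooth.continuous.snd.fst.continuousOn hper
  refine h.lagVelocity_ne_zero s ?_
  rw [lagVelocity, ← (h.hasDerivAt_fst s).deriv, ← (h.hasDerivAt_snd_fst s).deriv, h0, hs]
  simp

theorem add_integral_eq (h : IsLegendrianLoop γ) (s : ℝ) :
    (γ 0).2.2 + ∫ σ in (0:ℝ)..s, (γ σ).2.1 * deriv (fun t => (γ t).1) σ = (γ s).2.2 := by
  simp only [← h.tangent]
  rw [intervalIntegral.integral_deriv_eq_sub' _ rfl
    (fun σ _ => (h.hasDerivAt_snd_snd σ).differentiableAt), add_sub_cancel]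
  exact (h.smooth.snd.snd.continuous_deriv (by simp)).continuousOn

theorem integral_eq_zero (h : IsLegendrianLoop γ) :
    ∫ σ in (0:ℝ)..1, (γ σ).2.1 * deriv (fun t => (γ t).1) σ = 0 := by
  have h1 := h.add_integral_eq 1
  have h2 := h.periodic 0
  rw [zero_add] at h2
  rw [h2] at h1
  linarith

end IsLegendrianLoop

/-- Legendrian loops with equal rotation numbers are Legendrian regularly homotopic. -/
theorem exists_homotopy_of_rot_eq {γ₀ γ₁ : ℝ → ℝ × ℝ × ℝ} {n : ℤ}
    (h₀ : IsLegendrianLoop γ₀) (h₁ : IsLegendrianLoop γ₁)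
    (hr₀ : HasLegRotationNumber γ₀ n) (hr₁ : HasLegRotationNumber γ₁ n) :
    ∃ H : ℝ → ℝ → ℝ × ℝ × ℝ, IsLegendrianRegularHomotopy H ∧ H 0 = γ₀ ∧ H 1 = γ₁ := by
  obtain ⟨-, θ₀, hθ₀, pθ₀, hang₀⟩ := h₀.exists_smooth_angle hr₀
  obtain ⟨-, θ₁, hθ₁, pθ₁, hang₁⟩ := h₁.exists_smooth_angle hr₁
  let β : ℝ → ℝ := fun t => Real.smoothTransition (3 * t - 1)
  have hβ : ContDiff ℝ ∞ β := Real.smoothTransition.contDiff.comp (by fun_prop)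
  have hβ0 : ∀ t ≤ 1 / 3, β t = 0 := fun t ht =>
    Real.smoothTransition.zero_of_nonpos (by linarith)
  have hβ1 : ∀ t, 2 / 3 ≤ t → β t = 1 := fun t ht =>
    Real.smoothTransition.one_of_one_le (by linarith)
  obtain ⟨X, Y, hX, hY, harea, hpos, hend₀, hend₁⟩ := exists_zero_area_family
    h₀.smooth.fst h₀.smooth.snd.fst h₁.smooth.fst h₁.smooth.snd.fst
    (fun s => by rw [h₀.periodic]) (fun s => by rw [h₀.periodic])
    (fun s => by rw [h₁.periodic]) (fun s => by rw [h₁.periodic])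
    h₀.integral_eq_zero h₁.integral_eq_zero
    h₀.exists_deriv_fst_ne_zero h₁.exists_deriv_fst_ne_zero hβ
    (fun t => ⟨Real.smoothTransition.nonneg _, Real.smoothTransition.le_one _⟩)
  let θ : ℝ → ℝ → ℝ := fun t s => (1 - β t) * θ₀ s + β t * θ₁ s
  have hθ : ContDiff ℝ ∞ (Function.uncurry θ) :=
    ((contDiff_const.sub (hβ.comp contDiff_fst)).mul (hθ₀.comp contDiff_snd)).add
      ((hβ.comp contDiff_fst).mul (hθ₁.comp contDiff_snd))
  have pθ : ∀ t s, θ t (s + 1) = θ t s + n * (2 * Real.pi) := fun t s => by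
    simp only [θ, pθ₀, pθ₁]
    ring
  have hc : IsPeriodicFamily fun t s => Real.cos (θ t s) :=
    ⟨hθ.cos, fun t s => by rw [pθ, Real.cos_add_int_mul_two_pi]⟩
  have hd : IsPeriodicFamily fun t s => Real.sin (θ t s) :=
    ⟨hθ.sin, fun t s => by rw [pθ, Real.sin_add_int_mul_two_pi]⟩
  obtain ⟨C₁, hC₁⟩ := hX.deriv_snd.exists_bound
  obtain ⟨C₂, hC₂⟩ := hY.deriv_snd.exists_bound
  obtain ⟨C, hC, hCle⟩ : ∃ C ≥ (0:ℝ), C₁ ≤ C ∧ C₂ ≤ C := ⟨max 0 (max C₁ C₂), by simp⟩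
  let ρ : ℝ → ℝ := fun t =>
    (4 * C + 1) * (Real.smoothTransition (3 * t) * Real.smoothTransition (3 - 3 * t))
  have hρ : ContDiff ℝ ∞ ρ := contDiff_const.mul
    ((Real.smoothTransition.contDiff.comp (by fun_prop)).mul
      (Real.smoothTransition.contDiff.comp (by fun_prop)))
  have hρnn : ∀ t, 0 ≤ ρ t := fun t => mul_nonneg (by positivity)
    (mul_nonneg (Real.smoothTransition.nonneg _) (Real.smoothTransition.nonneg _))
  let ζ : ℝ → ℝ := fun t => (1 - β t) * (γ₀ 0).2.2 + β t * (γ₁ 0).2.2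
  have hζ : ContDiff ℝ ∞ ζ :=
    ((contDiff_const.sub hβ).mul contDiff_const).add (hβ.mul contDiff_const)
  have hcs : ∀ a : ℝ, Real.cos a ^ 2 + Real.sin a ^ 2 = 1 := Real.cos_sq_add_sin_sq
  obtain ⟨H, hH, hHend⟩ := exists_homotopy_of_oscillation hX hY hc hd hρ
    (by simp [ρ]) (by simp [ρ]) hζ (fun t _ => harea t) (fun t _ => hpos t) (by
      intro t ht s τ
      rcases le_total t (1 / 3) with h | h
      · obtain ⟨r, hr, hx, hy⟩ := hang₀ s
        have hθt : θ t s = θ₀ s := by simp [θ, hβ0 t h]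
        rw [(hend₀ t (hβ0 t h)).1, (hend₀ t (hβ0 t h)).2, (h₀.hasDerivAt_fst s).deriv,
          (h₀.hasDerivAt_snd_fst s).deriv, hx, hy, hθt]
        exact add_smul_figureEight_ne_zero hr (hρnn t) (hcs _) τ
      rcases le_total (2 / 3) t with h' | h'
      · obtain ⟨r, hr, hx, hy⟩ := hang₁ s
        have hθt : θ t s = θ₁ s := by simp [θ, hβ1 t h']
        rw [(hend₁ t (hβ1 t h')).1, (hend₁ t (hβ1 t h')).2, (h₁.hasDerivAt_fst s).deriv,
          (h₁.hasDerivAt_snd_fst s).deriv, hx, hy, hθt]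
        exact add_smul_figureEight_ne_zero hr (hρnn t) (hcs _) τ
      · have hρt : ρ t = 4 * C + 1 := by
          simp only [ρ]
          rw [Real.smoothTransition.one_of_one_le (by linarith),
            Real.smoothTransition.one_of_one_le (by linarith)]
          ring
        exact add_large_smul_figureEight_ne_zero ((hC₁ t ht s).trans hCle.1)
          ((hC₂ t ht s).trans hCle.2) (by rw [hρt]; linarith) (hcs _) τ)
  refine ⟨H, hH, ?_, ?_⟩ <;> funext s
  · have hb : β 0 = 0 := hβ0 0 (by norm_num)
    rw [hHend 0 (Or.inl rfl) s, (hend₀ 0 hb).1, (hend₀ 0 hb).2]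
    have hζ0 : ζ 0 = (γ₀ 0).2.2 := by simp [ζ, hb]
    rw [hζ0, h₀.add_integral_eq]
  · have hb : β 1 = 1 := hβ1 1 (by norm_num)
    rw [hHend 1 (Or.inr rfl) s, (hend₁ 1 hb).1, (hend₁ 1 hb).2]
    have hζ1 : ζ 1 = (γ₁ 0).2.2 := by simp [ζ, hb]
    rw [hζ1, h₁.add_integral_eq]

/-- Two Legendrian immersed loops in `(ℝ³, ξ)` are Legendrian regularly
homotopic if and only if their rotation numbers agree. -/
theorem legendrian_regular_homotopic_iff_rot_eq
    (γ₀ γ₁ : ℝ → ℝ × ℝ × ℝ) (n₀ n₁ : ℤ)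
    (h₀ : IsLegendrianLoop γ₀) (h₁ : IsLegendrianLoop γ₁)
    (hr₀ : HasLegRotationNumber γ₀ n₀) (hr₁ : HasLegRotationNumber γ₁ n₁) :
    (∃ H : ℝ → ℝ → ℝ × ℝ × ℝ,
        IsLegendrianRegularHomotopy H ∧ H 0 = γ₀ ∧ H 1 = γ₁) ↔ n₀ = n₁ := by
  constructor
  · rintro ⟨H, hH, rfl, rfl⟩
    exact hH.rot_eq hr₀ hr₁
  · rintro rfl
    exact exists_homotopy_of_rot_eq h₀ h₁ hr₀ hr₁
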